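/- Fix d ≥ 2, k ≥ 1 and v ∈ [0,1]. Define the symmetric data μ̃_ij for i ≠ j by: μ̃_1j = v and μ̃_j1 = 1 − v for every j ∈ {2,...,d}, and μ̃_ij = 1/2 for all i, j ∈ {2,...,d} with i ≠ j. Let ℓ(μ̃; θ) = k · Σ_{1 ≤ i < j ≤ d} [log(e^{θ_i}+e^{θ_j}) − μ̃_ij θ_i − μ̃_ji θ_j], let Θ_∞ = {θ ∈ ℝ^d : Σ_i θ_i = 0} and Θ_oracle = {θ ∈ ℝ^d : θ₂ = θ₃ = ⋯ = θ_d}. Then θ̂ minimizes ℓ(μ̃; ·) over Θ_∞ if and only if θ̂ minimizes ℓ(μ̃; ·) over Θ_∞ ∩ Θ_oracle; in particular a minimizer over Θ_∞ exists if and only if a minimizer over Θ_∞ ∩ Θ_oracle exists, and when they exist they coincide. Likewise, for any B > 0, θ̂ minimizes ℓ(μ̃; ·) over Θ_B = {θ : ‖θ‖_∞ ≤ B, Σ_i θ_i = 0} if and only if it minimizes ℓ(μ̃; ·) over Θ_B ∩ Θ_oracle. -/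

import Mathlib

open Finset

/-- The negative log-likelihood of the BTL model given observed win fractions `μ`:
`ℓ(θ) = k ∑_{i<j} [log(e^{θ_i}+e^{θ_j}) - μ_ij θ_i - μ_ji θ_j]`. -/
noncomputable def nll (d k : ℕ) (μ : Fin d → Fin d → ℝ) (θ : Fin d → ℝ) : ℝ :=
  (k : ℝ) * ∑ i : Fin d, ∑ j : Fin d,
    if i < j then
      Real.log (Real.exp (θ i) + Real.exp (θ j)) - μ i j * θ i - μ j i * θ j
    else 0

/-- The parameter domain `Θ_A = {θ : ‖θ‖_∞ ≤ A, ∑ θ_i = 0}`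
(the norm on `Fin d → ℝ` is the sup norm). -/
def paramSet (d : ℕ) (A : ℝ) : Set (Fin d → ℝ) :=
  {θ | ‖θ‖ ≤ A ∧ ∑ i, θ i = 0}

/-- The symmetric 'oracle' data `μ̃`: item `1` (index `0`) beats each other item
with fraction `v`, each other item beats item `1` with fraction `1 − v`, and any
two items among `2, …, d` beat each other with fraction `1/2`. -/
noncomputable def oracleData (d : ℕ) (v : ℝ) : Fin d → Fin d → ℝ :=
  fun i j => if i.val = 0 then v else if j.val = 0 then 1 - v else 1 / 2

/-- The 'oracle' set `Θ_oracle = {θ : θ₂ = θ₃ = ⋯ = θ_d}` of vectors whose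
coordinates other than the first all agree. -/
def oracleSet (d : ℕ) : Set (Fin d → ℝ) :=
  {θ | ∀ i j : Fin d, i.val ≠ 0 → j.val ≠ 0 → θ i = θ j}

/-- The tangent-line inequality for the convex function `x ↦ log (e^c + e^x)` at `m`. -/
theorem log_exp_add_exp_tangent_le (c m x : ℝ) :
    Real.log (Real.exp c + Real.exp m) +
        Real.exp m / (Real.exp c + Real.exp m) * (x - m) ≤
      Real.log (Real.exp c + Real.exp x) := by
  have hc := Real.exp_pos c
  have hm := Real.exp_pos m
  have hs : 0 < Real.exp c + Real.exp m := add_pos hc hm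
  have hconv := convexOn_exp.2 (Set.mem_univ (0 : ℝ)) (Set.mem_univ (x - m))
    (div_pos hc hs).le (div_pos hm hs).le (by field_simp)
  simp only [smul_eq_mul, mul_zero, zero_add, Real.exp_zero, mul_one] at hconv
  rw [Real.le_log_iff_exp_le (add_pos hc (Real.exp_pos x)), Real.exp_add, Real.exp_log hs]
  refine (mul_le_mul_of_nonneg_left hconv hs.le).trans_eq ?_
  rw [Real.exp_sub]
  field_simp

theorem log_exp_add_exp_self (a : ℝ) :
    Real.log (Real.exp a + Real.exp a) = Real.log 2 + a := by
  rw [← two_mul, Real.log_mul two_ne_zero (Real.exp_ne_zero a), Real.log_exp]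

theorem log_two_add_midpoint_lt {a b : ℝ} (hab : a ≠ b) :
    Real.log 2 + (a + b) / 2 < Real.log (Real.exp a + Real.exp b) := by
  rw [Real.lt_log_iff_exp_lt (add_pos (Real.exp_pos a) (Real.exp_pos b)), Real.exp_add,
    Real.exp_log two_pos]
  have ha : Real.exp a = Real.exp (a / 2) ^ 2 := by rw [← Real.exp_nat_mul]; ring_nf
  have hb : Real.exp b = Real.exp (b / 2) ^ 2 := by rw [← Real.exp_nat_mul]; ring_nf
  have hm : Real.exp ((a + b) / 2) = Real.exp (a / 2) * Real.exp (b / 2) := by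
    rw [← Real.exp_add]; ring_nf
  have hne : Real.exp (a / 2) - Real.exp (b / 2) ≠ 0 := by
    rw [sub_ne_zero, Real.exp_injective.ne_iff]
    contrapose! hab
    linarith
  rw [ha, hb, hm]
  nlinarith [sq_pos_of_ne_zero hne]

theorem log_two_add_midpoint_le (a b : ℝ) :
    Real.log 2 + (a + b) / 2 ≤ Real.log (Real.exp a + Real.exp b) := by
  rcases eq_or_ne a b with rfl | hab
  · rw [log_exp_add_exp_self]
    linarith
  · exact (log_two_add_midpoint_lt hab).le

/-- The vector obtained from `θ` by replacing all coordinates but the first by their mean. -/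
noncomputable def tailAverage {n : ℕ} (θ : Fin (n + 1) → ℝ) : Fin (n + 1) → ℝ :=
  Fin.cons (θ 0) fun _ => (∑ j : Fin n, θ j.succ) / n

theorem tailAverage_mem_oracleSet {n : ℕ} (θ : Fin (n + 1) → ℝ) :
    tailAverage θ ∈ oracleSet (n + 1) := by
  intro i j hi hj
  obtain ⟨i, rfl⟩ := Fin.exists_succ_eq.2 (Fin.val_ne_zero_iff.1 hi)
  obtain ⟨j, rfl⟩ := Fin.exists_succ_eq.2 (Fin.val_ne_zero_iff.1 hj)
  simp [tailAverage]

theorem sum_tailAverage {n : ℕ} (hn : n ≠ 0) (θ : Fin (n + 1) → ℝ) :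
    ∑ i, tailAverage θ i = ∑ i, θ i := by
  simp only [Fin.sum_univ_succ, tailAverage, Fin.cons_zero, Fin.cons_succ, sum_const, card_univ,
    Fintype.card_fin, nsmul_eq_mul]
  field_simp

theorem norm_tailAverage_le {n : ℕ} (hn : n ≠ 0) (θ : Fin (n + 1) → ℝ) :
    ‖tailAverage θ‖ ≤ ‖θ‖ := by
  rw [pi_norm_le_iff_of_nonneg (norm_nonneg θ)]
  intro i
  refine Fin.cases ?_ (fun j => ?_) i
  · exact norm_le_pi_norm θ 0
  · have hn' : (0 : ℝ) < n := by positivity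
    simp only [tailAverage, Fin.cons_succ, norm_div, RCLike.norm_natCast]
    rw [div_le_iff₀ hn']
    refine (norm_sum_le_of_le _ fun j _ => norm_le_pi_norm θ (Fin.succ j)).trans_eq ?_
    simp [mul_comm]

theorem nll_oracleData_succ (n k : ℕ) (v : ℝ) (θ : Fin (n + 1) → ℝ) :
    nll (n + 1) k (oracleData (n + 1) v) θ = k *
      ((∑ j : Fin n, (Real.log (Real.exp (θ 0) + Real.exp (θ j.succ)) - v * θ 0
          - (1 - v) * θ j.succ)) +
        ∑ i : Fin n, ∑ j : Fin n, if i < j then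
          Real.log (Real.exp (θ i.succ) + Real.exp (θ j.succ)) - 1 / 2 * θ i.succ
            - 1 / 2 * θ j.succ
        else 0) := by
  simp [nll, oracleData, Fin.sum_univ_succ]

/-- Averaging the exchangeable coordinates strictly decreases the oracle likelihood
unless they already agree. -/
theorem nll_tailAverage_lt {n k : ℕ} (hn : n ≠ 0) (hk : k ≠ 0) (v : ℝ)
    {θ : Fin (n + 1) → ℝ} (hθ : θ ∉ oracleSet (n + 1)) :
    nll (n + 1) k (oracleData (n + 1) v) (tailAverage θ) <
      nll (n + 1) k (oracleData (n + 1) v) θ := by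
  have hpair : ∃ i j : Fin n, i < j ∧ θ i.succ ≠ θ j.succ := by
    simp only [oracleSet, Set.mem_ofPred_eq, not_forall] at hθ
    obtain ⟨i, j, hi, hj, hij⟩ := hθ
    obtain ⟨i, rfl⟩ := Fin.exists_succ_eq.2 (Fin.val_ne_zero_iff.1 hi)
    obtain ⟨j, rfl⟩ := Fin.exists_succ_eq.2 (Fin.val_ne_zero_iff.1 hj)
    have hne : i ≠ j := fun h => hij (by rw [h])
    rcases lt_or_gt_of_ne hne with h | h
    · exact ⟨i, j, h, hij⟩
    · exact ⟨j, i, h, Ne.symm hij⟩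
  rw [nll_oracleData_succ, nll_oracleData_succ]
  refine mul_lt_mul_of_pos_left ?_ (by positivity)
  simp only [tailAverage, Fin.cons_zero, Fin.cons_succ]
  set m : ℝ := (∑ j : Fin n, θ j.succ) / n with hm
  have hdev : ∑ j : Fin n, (θ j.succ - m) = 0 := by
    rw [sum_sub_distrib, sum_const, card_univ, Fintype.card_fin, nsmul_eq_mul, hm]
    field_simp
    ring
  refine add_lt_add_of_le_of_lt ?_ ?_
  · set s : ℝ := Real.exp m / (Real.exp (θ 0) + Real.exp m)
    calc ∑ _j : Fin n, (Real.log (Real.exp (θ 0) + Real.exp m) - v * θ 0 - (1 - v) * m)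
        = ∑ j : Fin n, ((Real.log (Real.exp (θ 0) + Real.exp m) - v * θ 0 - (1 - v) * m)
            + (s - (1 - v)) * (θ j.succ - m)) := by
          rw [sum_add_distrib, ← mul_sum, hdev, mul_zero, add_zero]
      _ ≤ _ := sum_le_sum fun j _ => by
          linarith [log_exp_add_exp_tangent_le (θ 0) m (θ j.succ)]
  · have hle : ∀ i j : Fin n,
        (if i < j then Real.log (Real.exp m + Real.exp m) - 1 / 2 * m - 1 / 2 * m else 0) ≤
          if i < j then Real.log (Real.exp (θ i.succ) + Real.exp (θ j.succ))
            - 1 / 2 * θ i.succ - 1 / 2 * θ j.succ else 0 := by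
      intro i j
      split_ifs
      · linarith [log_exp_add_exp_self m, log_two_add_midpoint_le (θ i.succ) (θ j.succ)]
      · exact le_rfl
    obtain ⟨i, j, hij, hne⟩ := hpair
    refine sum_lt_sum (fun i _ => sum_le_sum fun j _ => hle i j)
      ⟨i, mem_univ i, sum_lt_sum (fun j _ => hle i j) ⟨j, mem_univ j, ?_⟩⟩
    rw [if_pos hij, if_pos hij]
    linarith [log_exp_add_exp_self m, log_two_add_midpoint_lt hne]

/-- If a self-map of `S` with values in `O` strictly decreases `f` off `O`, then the minimizers
of `f` over `S` and over `S ∩ O` coincide. -/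
theorem minimizer_iff_of_retract {α : Type*} {f : α → ℝ} {S O : Set α} {P : α → α}
    (hPS : ∀ x ∈ S, P x ∈ S) (hPO : ∀ x, P x ∈ O) (hlt : ∀ x, x ∉ O → f (P x) < f x) (a : α) :
    (a ∈ S ∧ ∀ x ∈ S, f a ≤ f x) ↔ (a ∈ S ∧ a ∈ O ∧ ∀ x ∈ S, x ∈ O → f a ≤ f x) := by
  constructor
  · rintro ⟨ha, hmin⟩
    refine ⟨ha, ?_, fun x hx _ => hmin x hx⟩
    by_contra haO
    exact (hlt a haO).not_ge (hmin _ (hPS a ha))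
  · rintro ⟨ha, -, hmin⟩
    refine ⟨ha, fun x hx => ?_⟩
    by_cases hxO : x ∈ O
    · exact hmin x hx hxO
    · exact (hmin _ (hPS x hx) (hPO x)).trans (hlt x hxO).le

/-- Lemma 11: with the symmetric oracle data `μ̃`, a vector
`θ̂` minimizes `ℓ(μ̃; ·)` over `Θ_∞ = {θ : ∑ θ_i = 0}` if and only if it
minimizes `ℓ(μ̃; ·)` over `Θ_∞ ∩ Θ_oracle`; likewise for the box-constrained
domain `Θ_B` in place of `Θ_∞`. In particular minimizers over the two domains
exist simultaneously and coincide. -/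
theorem oracle_mle_symmetry (d k : ℕ) (hd : 2 ≤ d) (hk : 1 ≤ k)
    (v : ℝ) (hv0 : 0 ≤ v) (hv1 : v ≤ 1) (B : ℝ) (hB : 0 < B)
    (θhat : Fin d → ℝ) :
    (((∑ i, θhat i = 0) ∧
        ∀ θ : Fin d → ℝ, (∑ i, θ i = 0) →
          nll d k (oracleData d v) θhat ≤ nll d k (oracleData d v) θ) ↔
      ((∑ i, θhat i = 0) ∧ θhat ∈ oracleSet d ∧
        ∀ θ : Fin d → ℝ, (∑ i, θ i = 0) → θ ∈ oracleSet d →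
          nll d k (oracleData d v) θhat ≤ nll d k (oracleData d v) θ)) ∧
    ((θhat ∈ paramSet d B ∧
        ∀ θ ∈ paramSet d B,
          nll d k (oracleData d v) θhat ≤ nll d k (oracleData d v) θ) ↔
      (θhat ∈ paramSet d B ∧ θhat ∈ oracleSet d ∧
        ∀ θ ∈ paramSet d B, θ ∈ oracleSet d →
          nll d k (oracleData d v) θhat ≤ nll d k (oracleData d v) θ)) := by
  obtain ⟨n, rfl⟩ : ∃ n, d = n + 1 := ⟨d - 1, by omega⟩
  have hn : n ≠ 0 := by omega
  have hlt : ∀ θ : Fin (n + 1) → ℝ, θ ∉ oracleSet (n + 1) → _ :=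
    fun θ hθ => nll_tailAverage_lt hn (by omega : k ≠ 0) v hθ
  refine ⟨minimizer_iff_of_retract (S := {θ : Fin (n + 1) → ℝ | ∑ i, θ i = 0}) (fun θ hθ => ?_)
      tailAverage_mem_oracleSet hlt θhat,
    minimizer_iff_of_retract (S := paramSet (n + 1) B) (fun θ hθ => ⟨?_, ?_⟩)
      tailAverage_mem_oracleSet hlt θhat⟩
  · exact (sum_tailAverage hn θ).trans hθ
  · exact (norm_tailAverage_le hn θ).trans hθ.1
  · exact (sum_tailAverage hn θ).trans hθ.2
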